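/- If T is (n, k+1)-quasi-*-paranormal, then T is (n+1, k)-quasiparanormal, i.e., ‖T^{n+2}(T^k x)‖·‖T^k x‖^{n+1} ≥ ‖T(T^k x)‖^{n+2} for all x ∈ H. -/

import Mathlib

open ContinuousLinearMap

theorem norm_apply_sq_le_norm_adjoint_apply_mul_norm {H : Type*} [NormedAddCommGroup H]
    [InnerProductSpace ℂ H] [CompleteSpace H] (T : H →L[ℂ] H) (y : H) :
    ‖T y‖ ^ 2 ≤ ‖(adjoint T) (T y)‖ * ‖y‖ := by
  have h : inner ℂ ((adjoint T) (T y)) y = (‖T y‖ : ℂ) ^ 2 := by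
    rw [adjoint_inner_left]
    exact inner_self_eq_norm_sq_to_K _
  have h' := norm_inner_le_norm (𝕜 := ℂ) ((adjoint T) (T y)) y
  rw [h] at h'
  simpa using h'

/-- If `T` is `(n, k+1)`-quasi-*-paranormal, then `T` is `(n+1, k)`-quasiparanormal. -/
theorem stmt_1 {H : Type*} [NormedAddCommGroup H] [InnerProductSpace ℂ H] [CompleteSpace H]
    (T : H →L[ℂ] H) (n k : ℕ)
    (hT : ∀ x : H, ‖(adjoint T) (T ^ (k + 1) <| x)‖ ^ (n + 1) ≤
      ‖T ^ (n + 1) <| T ^ (k + 1) <| x‖ * ‖T ^ (k + 1) <| x‖ ^ n) :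
    ∀ x : H, ‖T (T ^ k <| x)‖ ^ (n + 2) ≤ ‖T ^ (n + 2) <| T ^ k <| x‖ * ‖T ^ k <| x‖ ^ (n + 1) := by
  intro x
  have hx := hT x
  have hk : (T ^ (k + 1)) x = T ((T ^ k) x) := by rw [pow_succ']; rfl
  have hn (y : H) : (T ^ (n + 2)) y = (T ^ (n + 1)) (T y) := by rw [pow_succ]; rfl
  rw [hk] at hx
  rw [hn]
  generalize (T ^ k) x = y at hx ⊢
  rcases (norm_nonneg (T y)).eq_or_lt with h0 | h0
  · rw [← h0, zero_pow (by omega)]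
    positivity
  · refine le_of_mul_le_mul_left ?_ (pow_pos h0 n)
    calc ‖T y‖ ^ n * ‖T y‖ ^ (n + 2) = (‖T y‖ ^ 2) ^ (n + 1) := by ring
      _ ≤ (‖(adjoint T) (T y)‖ * ‖y‖) ^ (n + 1) := by
        gcongr
        exact norm_apply_sq_le_norm_adjoint_apply_mul_norm T y
      _ = ‖(adjoint T) (T y)‖ ^ (n + 1) * ‖y‖ ^ (n + 1) := mul_pow _ _ _
      _ ≤ ‖(T ^ (n + 1)) (T y)‖ * ‖T y‖ ^ n * ‖y‖ ^ (n + 1) := by gcongr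
      _ = ‖T y‖ ^ n * (‖(T ^ (n + 1)) (T y)‖ * ‖y‖ ^ (n + 1)) := by ring
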